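/- For every real α with α ≥ 0 or α < −2.679, the planar system ẋ = y, ẏ = −x³ + αx²y + y³ has no nonconstant periodic solution (no limit cycles). -/

import Mathlib

/-- `(x,y)` is a solution of `ẋ = y`, `ẏ = -x³ + αx²y + y³`. -/
def IsSolXY (α : ℝ) (x y : ℝ → ℝ) : Prop :=
  ∀ t : ℝ, HasDerivAt x (y t) t ∧
    HasDerivAt y (-(x t) ^ 3 + α * (x t) ^ 2 * y t + (y t) ^ 3) t

/-- `(x,y)` is periodic with some positive period. -/
def IsPeriodicSol (x y : ℝ → ℝ) : Prop :=
  ∃ T : ℝ, 0 < T ∧ ∀ t : ℝ, x (t + T) = x t ∧ y (t + T) = y t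

/-- `(x,y)` is nonconstant. -/
def NonconstSol (x y : ℝ → ℝ) : Prop := ∃ t s : ℝ, (x t, y t) ≠ (x s, y s)

open Filter Topology Set

/-- A function that is nonnegative at `t`, and strictly decreasing there whenever it vanishes,
is positive immediately before `t`. -/
theorem eventually_pos_left_of_hasDerivAt {h : ℝ → ℝ} {h' t : ℝ} (hd : HasDerivAt h h' t)
    (h0 : 0 ≤ h t) (hneg : h t = 0 → h' < 0) : ∀ᶠ s in 𝓝[<] t, 0 < h s := by
  rcases h0.lt_or_eq with hp | hz
  · exact (hd.continuousAt.eventually (lt_mem_nhds hp)).filter_mono nhdsWithin_le_nhds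
  · have hs := (hasDerivAt_iff_tendsto_slope_left_right.1 hd).1
    filter_upwards [hs.eventually (gt_mem_nhds (hneg hz.symm)), self_mem_nhdsWithin] with s hs hst
    rw [slope_def_field, ← hz, sub_zero] at hs
    by_contra! hle
    exact absurd (div_nonneg_of_nonpos hle (sub_nonpos.2 (le_of_lt hst))) (not_le.2 hs)

/-- A function whose derivative is positive immediately before `t` is smaller there
than at `t`. -/
theorem eventually_lt_left_of_deriv_pos {x y : ℝ → ℝ} {t : ℝ} (hx : ∀ s, HasDerivAt x (y s) s)
    (hy : ∀ᶠ s in 𝓝[<] t, 0 < y s) : ∀ᶠ s in 𝓝[<] t, x s < x t := by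
  obtain ⟨l, hl, hpos⟩ := (mem_nhdsLT_iff_exists_Ioo_subset).1 hy
  have hmono : StrictMonoOn x (Icc l t) := by
    refine strictMonoOn_of_deriv_pos (convex_Icc l t)
      (fun s _ => (hx s).continuousAt.continuousWithinAt) fun s hs => ?_
    rw [interior_Icc] at hs
    rw [(hx s).deriv]
    exact hpos hs
  filter_upwards [Ioo_mem_nhdsLT hl] with s hs
  exact hmono ⟨hs.1.le, hs.2.le⟩ (right_mem_Icc.2 (le_of_lt hl)) hs.2

/-- A periodic function with nonpositive derivative has zero derivative. -/
theorem hasDerivAt_eq_zero_of_periodic_of_nonpos {F F' : ℝ → ℝ} {T : ℝ} (hT : 0 < T)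
    (hF : ∀ t, HasDerivAt F (F' t) t) (hle : ∀ t, F' t ≤ 0) (hper : ∀ t, F (t + T) = F t)
    (t : ℝ) : F' t = 0 := by
  have hanti : Antitone F := antitone_of_deriv_nonpos (fun t => (hF t).differentiableAt)
    fun t => by rw [(hF t).deriv]; exact hle t
  have hc : ∀ u, F u = F t := by
    have hper' : Function.Periodic F T := hper
    intro u
    obtain ⟨v, hv, hvu⟩ := hper'.exists_mem_Ico hT u t
    rw [hvu]
    exact le_antisymm (hanti hv.1) (hper t ▸ hanti hv.2.le)
  have hcf : F = fun _ => F t := funext hc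
  have hd := hF t
  rw [hcf] at hd
  exact hd.unique (hasDerivAt_const t _)

/-- The second component of the vector field. -/
def fieldY (α x y : ℝ) : ℝ := -x ^ 3 + α * x ^ 2 * y + y ^ 3

/-- A region of the closed upper half plane, lying above a curve that the flow crosses downwards
when `α ≤ -2.679`. -/
def UpperBarrier (x y : ℝ) : Prop :=
  0 ≤ y ∧ ((x ≤ -1 ∧ 0 ≤ y + 2 / 5 * x - 1 / 10) ∨
    (-1 ≤ x ∧ x ≤ -1 / 2 ∧ 0 ≤ y - (32 / 100 + 4 / 100 * x + 22 / 100 * x ^ 2)) ∨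
    (-1 / 2 ≤ x ∧ x ≤ 0 ∧ 0 ≤ y - (355 / 1000 + 18 / 100 * x + 36 / 100 * x ^ 2)) ∨
    (0 ≤ x ∧ x ≤ 1 / 2 ∧ 0 ≤ y - (355 / 1000 + 38 / 100 * x - 84 / 100 * x ^ 2)) ∨
    (1 / 2 ≤ x ∧ 0 ≤ x - 3 / 4 + 215 / 100 * y ^ 2 + 1 / 100 * y))

theorem fieldY_le {α x y : ℝ} (hα : α ≤ -(2679 / 1000)) (hy : 0 ≤ y) :
    fieldY α x y ≤ fieldY (-(2679 / 1000)) x y := by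
  have := mul_le_mul_of_nonneg_right hα (mul_nonneg (sq_nonneg x) hy)
  unfold fieldY
  linarith

theorem fieldY_lt_line {x y : ℝ} (hx : x ≤ -1) (h : y + 2 / 5 * x - 1 / 10 = 0) :
    fieldY (-(2679 / 1000)) x y + 2 / 5 * y < 0 := by
  obtain rfl : y = 1 / 10 - 2 / 5 * x := by linarith
  obtain ⟨s, hs, rfl⟩ : ∃ s, 0 ≤ s ∧ x = -1 - s := ⟨-1 - x, by linarith, by ring⟩
  unfold fieldY
  have := pow_nonneg hs 3
  have := pow_nonneg hs 2
  nlinarith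

theorem fieldY_lt_left_parabola {x y : ℝ} (h₁ : -1 ≤ x) (h₂ : x ≤ -1 / 2)
    (h : y - (32 / 100 + 4 / 100 * x + 22 / 100 * x ^ 2) = 0) :
    fieldY (-(2679 / 1000)) x y - (4 / 100 + 44 / 100 * x) * y < 0 := by
  obtain rfl : y = 32 / 100 + 4 / 100 * x + 22 / 100 * x ^ 2 := by linarith
  have hu : 0 ≤ x + 1 := by linarith
  have hv : 0 ≤ -1 / 2 - x := by linarith
  unfold fieldY
  linarith [mul_nonneg (pow_nonneg hu 0) (pow_nonneg hv 6),
    mul_nonneg (pow_nonneg hu 1) (pow_nonneg hv 5),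
    mul_nonneg (pow_nonneg hu 2) (pow_nonneg hv 4),
    mul_nonneg (pow_nonneg hu 3) (pow_nonneg hv 3),
    mul_nonneg (pow_nonneg hu 4) (pow_nonneg hv 2),
    mul_nonneg (pow_nonneg hu 5) (pow_nonneg hv 1),
    mul_nonneg (pow_nonneg hu 6) (pow_nonneg hv 0)]

theorem fieldY_lt_middle_parabola {x y : ℝ} (h₁ : -1 / 2 ≤ x) (h₂ : x ≤ 0)
    (h : y - (355 / 1000 + 18 / 100 * x + 36 / 100 * x ^ 2) = 0) :
    fieldY (-(2679 / 1000)) x y - (18 / 100 + 72 / 100 * x) * y < 0 := by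
  obtain rfl : y = 355 / 1000 + 18 / 100 * x + 36 / 100 * x ^ 2 := by linarith
  have hu : 0 ≤ x + 1 / 2 := by linarith
  have hv : 0 ≤ -x := by linarith
  unfold fieldY
  linarith [mul_nonneg (pow_nonneg hu 0) (pow_nonneg hv 8),
    mul_nonneg (pow_nonneg hu 1) (pow_nonneg hv 7),
    mul_nonneg (pow_nonneg hu 2) (pow_nonneg hv 6),
    mul_nonneg (pow_nonneg hu 3) (pow_nonneg hv 5),
    mul_nonneg (pow_nonneg hu 4) (pow_nonneg hv 4),
    mul_nonneg (pow_nonneg hu 5) (pow_nonneg hv 3),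
    mul_nonneg (pow_nonneg hu 6) (pow_nonneg hv 2),
    mul_nonneg (pow_nonneg hu 7) (pow_nonneg hv 1),
    mul_nonneg (pow_nonneg hu 8) (pow_nonneg hv 0)]

theorem fieldY_lt_right_parabola {x y : ℝ} (h₁ : 0 ≤ x) (h₂ : x ≤ 1 / 2)
    (h : y - (355 / 1000 + 38 / 100 * x - 84 / 100 * x ^ 2) = 0) :
    fieldY (-(2679 / 1000)) x y - (38 / 100 - 168 / 100 * x) * y < 0 := by
  obtain rfl : y = 355 / 1000 + 38 / 100 * x - 84 / 100 * x ^ 2 := by linarith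
  unfold fieldY
  rcases le_total x (1 / 4) with h₃ | h₃
  · have hu : 0 ≤ x := by linarith
    have hv : 0 ≤ 1 / 4 - x := by linarith
    linarith [mul_nonneg (pow_nonneg hu 0) (pow_nonneg hv 6),
      mul_nonneg (pow_nonneg hu 1) (pow_nonneg hv 5),
      mul_nonneg (pow_nonneg hu 2) (pow_nonneg hv 4),
      mul_nonneg (pow_nonneg hu 3) (pow_nonneg hv 3),
      mul_nonneg (pow_nonneg hu 4) (pow_nonneg hv 2),
      mul_nonneg (pow_nonneg hu 5) (pow_nonneg hv 1),
      mul_nonneg (pow_nonneg hu 6) (pow_nonneg hv 0)]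
  · have hu : 0 ≤ x - 1 / 4 := by linarith
    have hv : 0 ≤ 1 / 2 - x := by linarith
    linarith [mul_nonneg (pow_nonneg hu 0) (pow_nonneg hv 6),
      mul_nonneg (pow_nonneg hu 1) (pow_nonneg hv 5),
      mul_nonneg (pow_nonneg hu 2) (pow_nonneg hv 4),
      mul_nonneg (pow_nonneg hu 3) (pow_nonneg hv 3),
      mul_nonneg (pow_nonneg hu 4) (pow_nonneg hv 2),
      mul_nonneg (pow_nonneg hu 5) (pow_nonneg hv 1),
      mul_nonneg (pow_nonneg hu 6) (pow_nonneg hv 0)]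

theorem fieldY_lt_sideways_parabola {x y : ℝ} (h₁ : 1 / 2 ≤ x) (hy : 0 ≤ y)
    (h : x - 3 / 4 + 215 / 100 * y ^ 2 + 1 / 100 * y = 0) :
    y + (430 / 100 * y + 1 / 100) * fieldY (-(2679 / 1000)) x y < 0 := by
  obtain rfl : x = 3 / 4 - 215 / 100 * y ^ 2 - 1 / 100 * y := by linarith
  have hy' : y ≤ 341 / 1000 := by nlinarith
  have hu : 0 ≤ y := by linarith
  have hv : 0 ≤ 341 / 1000 - y := by linarith
  unfold fieldY
  linarith [mul_nonneg (pow_nonneg hu 0) (pow_nonneg hv 7),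
    mul_nonneg (pow_nonneg hu 1) (pow_nonneg hv 6),
    mul_nonneg (pow_nonneg hu 2) (pow_nonneg hv 5),
    mul_nonneg (pow_nonneg hu 3) (pow_nonneg hv 4),
    mul_nonneg (pow_nonneg hu 4) (pow_nonneg hv 3),
    mul_nonneg (pow_nonneg hu 5) (pow_nonneg hv 2),
    mul_nonneg (pow_nonneg hu 6) (pow_nonneg hv 1),
    mul_nonneg (pow_nonneg hu 7) (pow_nonneg hv 0)]

theorem lyapunov_factor_neg {α x y : ℝ} (hα : α ≤ -(2679 / 1000)) (hy : 0 < y)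
    (hx₁ : -3 / 4 < x) (hx₂ : x < 3 / 4) (hU : ¬ UpperBarrier x y) :
    α * x ^ 2 * (1 - 315 / 100 * x * y) - 5 / 100 * y ^ 2 + 315 / 100 * x ^ 4
      - 315 / 100 * x * y ^ 3 < 0 := by
  simp only [UpperBarrier, hy.le, true_and, not_or, not_and, not_le] at hU
  obtain ⟨-, hA, hB, hC, hD⟩ := hU
  have hy2 : 0 < y ^ 2 := by positivity
  rcases le_total x 0 with hx | hx
  · obtain ⟨s, rfl⟩ : ∃ s, x = -s := ⟨-x, by ring⟩
    have hs : 0 ≤ s := by linarith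
    have hsy : 0 ≤ s * y := by positivity
    have hα' := mul_le_mul_of_nonneg_right hα
      (show 0 ≤ s ^ 2 * (1 + 315 / 100 * (s * y)) by positivity)
    have hs4 : s ^ 2 * s ^ 2 ≤ s ^ 2 * (9 / 16) := by gcongr; nlinarith
    have hquad : 315 / 100 * (s * y) * y ^ 2 < 9 / 10 * s ^ 2 + 5 / 100 * y ^ 2 := by
      rcases le_total s (1 / 2) with h | h
      · have hyb : y ≤ 355 / 1000 := by
          have := hB (by linarith) (by linarith)
          nlinarith
        have hyb2 : y ^ 2 ≤ 127 / 1000 := by nlinarith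
        have := mul_le_mul_of_nonneg_left hyb2 hsy
        nlinarith [sq_nonneg (s - 22 / 100 * y)]
      · have hyb : y ≤ 42 / 100 := by
          have := hA (by linarith) (by linarith)
          nlinarith
        have hyb2 : y ^ 2 ≤ 18 / 100 := by nlinarith
        have := mul_le_mul_of_nonneg_left hyb2 hsy
        nlinarith [mul_le_mul_of_nonneg_left hyb hs]
    have : 0 ≤ s ^ 2 * (s * y) := by positivity
    nlinarith
  · have hxy : 0 ≤ x * y := by positivity
    have hkey : 315 / 100 * (x ^ 2 + 2679 / 1000 * (x * y)) ≤ 2679 / 1000 := by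
      rcases le_total x (1 / 2) with h | h
      · have hyb : y ≤ 4 / 10 := by
          have := hC hx h
          nlinarith [sq_nonneg (x - 38 / 168)]
        nlinarith [mul_le_mul_of_nonneg_left hyb hx]
      · have hxb := hD h
        have hyb : y ≤ 342 / 1000 := by nlinarith
        have hxX : x ≤ 3 / 4 - 215 / 100 * y ^ 2 := by linarith
        have hcubic : 0 ≤ y * (y - 22 / 100) ^ 2 := by positivity
        have hquartic : y ^ 2 * y ^ 2 ≤ y ^ 2 * (342 / 1000 * y) := by gcongr; nlinarith
        have h1 := mul_le_mul hxX hxX hx (hx.trans hxX)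
        have h2 := mul_le_mul_of_nonneg_right hxX hy.le
        nlinarith [sq_nonneg (y - 22 / 100)]
    have hα' := mul_le_mul_of_nonneg_right hα
      (show 0 ≤ x ^ 2 * (1 - 315 / 100 * (x * y)) by
        have : 0 ≤ 1 - 315 / 100 * (x * y) := by nlinarith
        positivity)
    have h1 := mul_le_mul_of_nonneg_left hkey (sq_nonneg x)
    have : 0 ≤ (x * y) * y ^ 2 := by positivity
    nlinarith

theorem UpperBarrier.eventually_left {α : ℝ} (hα : α ≤ -(2679 / 1000)) {x y : ℝ → ℝ}
    (hsol : IsSolXY α x y) {t : ℝ} (hU : UpperBarrier (x t) (y t)) :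
    ∀ᶠ s in 𝓝[<] t, UpperBarrier (x s) (y s) ∧ x s < x t := by
  have hx : ∀ s, HasDerivAt x (y s) s := fun s => (hsol s).1
  have hy : HasDerivAt y (fieldY α (x t) (y t)) t := (hsol t).2
  obtain ⟨hy0, hU⟩ := hU
  have hf : fieldY α (x t) (y t) ≤ fieldY (-(2679 / 1000)) (x t) (y t) := fieldY_le hα hy0
  have hpos : ∀ᶠ s in 𝓝[<] t, 0 < y s := by
    refine eventually_pos_left_of_hasDerivAt hy hy0 fun h0 => ?_
    have hx0 : 1 / 2 ≤ x t := by
      rw [h0] at hU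
      rcases hU with h | h | h | h | h <;> nlinarith
    have := pow_pos (show 0 < x t by linarith) 3
    simp only [fieldY, h0]
    linarith
  have hlt := eventually_lt_left_of_deriv_pos hx hpos
  have hgt (c : ℝ) (hc : c < x t) : ∀ᶠ s in 𝓝[<] t, c < x s :=
    ((hx t).continuousAt.eventually (lt_mem_nhds hc)).filter_mono nhdsWithin_le_nhds
  have hquad (a b c : ℝ) (h : 0 ≤ y t - (a + b * x t + c * x t ^ 2))
      (hneg : y t - (a + b * x t + c * x t ^ 2) = 0 →
        fieldY (-(2679 / 1000)) (x t) (y t) - (b + 2 * c * x t) * y t < 0) :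
      ∀ᶠ s in 𝓝[<] t, 0 < y s - (a + b * x s + c * x s ^ 2) := by
    refine eventually_pos_left_of_hasDerivAt
      (hy.sub ((((hx t).const_mul b).const_add a).add (((hx t).pow 2).const_mul c))) h fun h0 => ?_
    have := hneg h0
    simp only [Nat.cast_ofNat, Nat.add_one_sub_one, pow_one]
    linarith
  by_cases h₁ : 1 / 2 < x t
  · have hD : 0 ≤ x t - 3 / 4 + 215 / 100 * y t ^ 2 + 1 / 100 * y t := by
      rcases hU with h | h | h | h | h <;> linarith
    have := eventually_pos_left_of_hasDerivAt
      ((((hx t).sub_const (3 / 4)).add ((hy.pow 2).const_mul (215 / 100))).add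
        (hy.const_mul (1 / 100))) hD fun h0 => by
          have := fieldY_lt_sideways_parabola h₁.le hy0 h0
          have := mul_le_mul_of_nonneg_left hf (show 0 ≤ 430 / 100 * y t + 1 / 100 by linarith)
          simp only [Nat.cast_ofNat, Nat.add_one_sub_one, pow_one]
          linarith
    filter_upwards [hpos, hlt, hgt _ h₁, this] with s h2 h3 h4 h5
    exact ⟨⟨h2.le, .inr <| .inr <| .inr <| .inr ⟨h4.le, h5.le⟩⟩, h3⟩
  by_cases h₂ : 0 < x t
  · have hC : 0 ≤ y t - (355 / 1000 + 38 / 100 * x t + -84 / 100 * x t ^ 2) := by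
      rcases hU with h | h | h | h | h
      iterate 4 linarith
      obtain hh : x t = 1 / 2 := by linarith
      rw [hh] at h ⊢
      nlinarith
    filter_upwards [hpos, hlt, hgt _ h₂, hquad _ _ _ hC fun h0 => by
      linarith [fieldY_lt_right_parabola (y := y t) h₂.le (not_lt.1 h₁) (by linarith)]] with s h2 h3 h4 h5
    exact ⟨⟨h2.le, .inr <| .inr <| .inr <| .inl ⟨h4.le, by linarith, by linarith⟩⟩, h3⟩
  by_cases h₃ : -1 / 2 < x t
  · have hB : 0 ≤ y t - (355 / 1000 + 18 / 100 * x t + 36 / 100 * x t ^ 2) := by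
      rcases hU with h | h | h | h | h
      iterate 3 linarith
      · obtain hh : x t = 0 := by linarith
        rw [hh] at h ⊢
        linarith
      · linarith
    filter_upwards [hpos, hlt, hgt _ h₃, hquad _ _ _ hB fun h0 => by
      linarith [fieldY_lt_middle_parabola (y := y t) h₃.le (not_lt.1 h₂) (by linarith)]] with s h2 h3 h4 h5
    exact ⟨⟨h2.le, .inr <| .inr <| .inl ⟨h4.le, by linarith, by linarith⟩⟩, h3⟩
  by_cases h₄ : -1 < x t
  · have hA : 0 ≤ y t - (32 / 100 + 4 / 100 * x t + 22 / 100 * x t ^ 2) := by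
      rcases hU with h | h | h | h | h
      iterate 2 linarith
      · obtain hh : x t = -1 / 2 := by linarith
        rw [hh] at h ⊢
        linarith
      iterate 2 linarith
    filter_upwards [hpos, hlt, hgt _ h₄, hquad _ _ _ hA fun h0 => by
      linarith [fieldY_lt_left_parabola (y := y t) h₄.le (not_lt.1 h₃) (by linarith)]] with s h2 h3 h4 h5
    exact ⟨⟨h2.le, .inr <| .inl ⟨h4.le, by linarith, by linarith⟩⟩, h3⟩
  · have hL : 0 ≤ y t - (1 / 10 + -2 / 5 * x t + 0 * x t ^ 2) := by
      rcases hU with h | h | h | h | h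
      · linarith
      · obtain hh : x t = -1 := by linarith
        rw [hh] at h ⊢
        linarith
      iterate 3 linarith
    filter_upwards [hpos, hlt, hquad _ _ _ hL fun h0 => by
      linarith [fieldY_lt_line (y := y t) (not_lt.1 h₄) (by linarith)]] with s h2 h3 h5
    exact ⟨⟨h2.le, .inl ⟨by linarith, by linarith⟩⟩, h3⟩

theorem isClosed_upperBarrier : IsClosed {p : ℝ × ℝ | UpperBarrier p.1 p.2} := by
  simp only [UpperBarrier, Set.ofPred_and, Set.ofPred_or]
  refine (isClosed_le ?_ ?_).inter (.union ?_ (.union ?_ (.union ?_ (.union ?_ ?_))))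
  iterate 2 fun_prop
  · refine (isClosed_le ?_ ?_).inter (isClosed_le ?_ ?_) <;> fun_prop
  iterate 3
    · refine (isClosed_le ?_ ?_).inter ((isClosed_le ?_ ?_).inter (isClosed_le ?_ ?_)) <;> fun_prop
  · refine (isClosed_le ?_ ?_).inter (isClosed_le ?_ ?_) <;> fun_prop

/-- Periodic orbits do not enter the barrier region: flowing backwards from it, `x` would keep
decreasing. -/
theorem IsPeriodicSol.not_upperBarrier {α : ℝ} (hα : α ≤ -(2679 / 1000)) {x y : ℝ → ℝ}
    (hper : IsPeriodicSol x y) (hsol : IsSolXY α x y) (t : ℝ) : ¬ UpperBarrier (x t) (y t) := by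
  intro hU
  obtain ⟨T, hT, hper⟩ := hper
  have hxp : Function.Periodic x T := fun t => (hper t).1
  have hyp : Function.Periodic y T := fun t => (hper t).2
  have hxc : Continuous x := continuous_iff_continuousAt.2 fun s => (hsol s).1.continuousAt
  have hyc : Continuous y := continuous_iff_continuousAt.2 fun s => (hsol s).2.continuousAt
  have hshift (s : ℝ) : ∃ u ∈ Icc 0 T, x s = x u ∧ y s = y u := by
    have hp : Function.Periodic (fun s => (x s, y s)) T := fun s => by simp only [hxp s, hyp s]
    obtain ⟨u, hu, he⟩ := hp.exists_mem_Ico₀ hT s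
    exact ⟨u, ⟨hu.1, hu.2.le⟩, Prod.mk.inj he⟩
  have hK : IsCompact (Icc 0 T ∩ {s | UpperBarrier (x s) (y s)}) :=
    isCompact_Icc.inter_right (isClosed_upperBarrier.preimage (hxc.prodMk hyc))
  obtain ⟨u, hu, hxu, hyu⟩ := hshift t
  rw [hxu, hyu] at hU
  obtain ⟨m, ⟨-, hmU⟩, hmin⟩ := hK.exists_isMinOn ⟨u, hu, hU⟩ hxc.continuousOn
  obtain ⟨s, hsU, hs⟩ := (UpperBarrier.eventually_left hα hsol hmU).exists
  obtain ⟨v, hv, hxv, hyv⟩ := hshift s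
  rw [hxv, hyv] at hsU
  have := hmin ⟨hv, hsU⟩
  simp only [mem_ofPred_eq, ← hxv] at this
  exact absurd hs (not_lt.2 this)

theorem IsPeriodicSol.lt_three_quarters {α : ℝ} (hα : α ≤ -(2679 / 1000)) {x y : ℝ → ℝ}
    (hper : IsPeriodicSol x y) (hsol : IsSolXY α x y) (t : ℝ) : x t < 3 / 4 := by
  obtain ⟨T, hT, hp⟩ := id hper
  have hxp : Function.Periodic x T := fun t => (hp t).1
  have hxc : Continuous x := continuous_iff_continuousAt.2 fun s => (hsol s).1.continuousAt
  obtain ⟨m, -, hm⟩ := isCompact_Icc.exists_isMaxOn (nonempty_Icc.2 hT.le) hxc.continuousOn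
  have hmax (s : ℝ) : x s ≤ x m := by
    obtain ⟨u, hu, he⟩ := hxp.exists_mem_Ico₀ hT s
    exact he ▸ hm ⟨hu.1, hu.2.le⟩
  have hy : y m = 0 :=
    IsLocalMax.hasDerivAt_eq_zero (Eventually.of_forall hmax) (hsol m).1
  by_contra! h
  have := hmax t
  refine hper.not_upperBarrier hα hsol m ⟨hy.ge, .inr <| .inr <| .inr <| .inr ⟨by linarith, ?_⟩⟩
  rw [hy]
  linarith

theorem IsSolXY.neg {α : ℝ} {x y : ℝ → ℝ} (h : IsSolXY α x y) :
    IsSolXY α (fun t => -x t) (fun t => -y t) := fun t => by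
  refine ⟨(h t).1.neg, (h t).2.neg.congr_deriv ?_⟩
  ring

theorem IsPeriodicSol.neg {x y : ℝ → ℝ} (h : IsPeriodicSol x y) :
    IsPeriodicSol (fun t => -x t) (fun t => -y t) := by
  obtain ⟨T, hT, h⟩ := h
  exact ⟨T, hT, fun t => by simp only [(h t).1, (h t).2, and_self]⟩

theorem IsPeriodicSol.snd_eq_zero_of_nonneg {α : ℝ} (hα : 0 ≤ α) {x y : ℝ → ℝ}
    (hper : IsPeriodicSol x y) (hsol : IsSolXY α x y) (t : ℝ) : y t = 0 := by
  obtain ⟨T, hT, hp⟩ := hper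
  have hF (t : ℝ) : HasDerivAt (fun t => -(y t ^ 2 / 2 + x t ^ 4 / 4))
      (-(α * x t ^ 2 * y t ^ 2 + y t ^ 4)) t := by
    refine ((((hsol t).2.pow 2).div_const 2).add
      (((hsol t).1.pow 4).div_const 4)).neg.congr_deriv ?_
    push_cast
    ring
  have h := hasDerivAt_eq_zero_of_periodic_of_nonpos hT hF
    (fun t => neg_nonpos.2 (by positivity))
    (fun t => by simp only [(hp t).1, (hp t).2]) t
  have : 0 ≤ α * x t ^ 2 * y t ^ 2 := by positivity
  have : 0 ≤ y t ^ 4 := by positivity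
  exact pow_eq_zero_iff (n := 4) (by norm_num) |>.1 (by linarith)

theorem IsPeriodicSol.snd_eq_zero_of_le {α : ℝ} (hα : α ≤ -(2679 / 1000)) {x y : ℝ → ℝ}
    (hper : IsPeriodicSol x y) (hsol : IsSolXY α x y) (t : ℝ) : y t = 0 := by
  obtain ⟨T, hT, hp⟩ := id hper
  let B (t : ℝ) : ℝ := α * x t ^ 2 * (1 - 315 / 100 * x t * y t) - 5 / 100 * y t ^ 2
    + 315 / 100 * x t ^ 4 - 315 / 100 * x t * y t ^ 3
  have hF (t : ℝ) : HasDerivAt (fun t => y t ^ 2 / 2 + x t ^ 4 / 4 - 105 / 100 * (x t * y t ^ 3))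
      (y t ^ 2 * B t) t := by
    refine (((((hsol t).2.pow 2).div_const 2).add (((hsol t).1.pow 4).div_const 4)).sub
      (((hsol t).1.mul ((hsol t).2.pow 3)).const_mul _)).congr_deriv ?_
    simp only [B, Pi.pow_apply]
    push_cast
    ring
  have hB (t : ℝ) (hy : y t ≠ 0) : B t < 0 := by
    have h₁ := hper.lt_three_quarters hα hsol t
    have h₂ := hper.neg.lt_three_quarters hα hsol.neg t
    rcases hy.lt_or_gt with hy | hy
    · have := lyapunov_factor_neg hα (neg_pos.2 hy) (by linarith) h₂
        (hper.neg.not_upperBarrier hα hsol.neg t)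
      simp only [B]
      linarith
    · exact lyapunov_factor_neg hα hy (by linarith) h₁ (hper.not_upperBarrier hα hsol t)
  have h := hasDerivAt_eq_zero_of_periodic_of_nonpos hT hF
    (fun t => by
      by_cases hy : y t = 0
      · simp [hy]
      · exact mul_nonpos_of_nonneg_of_nonpos (sq_nonneg _) (hB t hy).le)
    (fun t => by simp only [(hp t).1, (hp t).2]) t
  by_contra hy
  exact mul_ne_zero (pow_ne_zero 2 hy) (hB t hy).ne h

/-- For `α ≥ 0` or `α < -2.679` the system `ẋ = y`, `ẏ = -x³ + αx²y + y³` has no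
nonconstant periodic solution. -/
theorem no_limit_cycle_gasull (α : ℝ) (hα : 0 ≤ α ∨ α < -(2679 / 1000 : ℝ)) :
    ¬ ∃ x y : ℝ → ℝ, IsSolXY α x y ∧ IsPeriodicSol x y ∧ NonconstSol x y := by
  rintro ⟨x, y, hsol, hper, t, s, hne⟩
  have hy : ∀ t, y t = 0 := hα.elim (fun h => hper.snd_eq_zero_of_nonneg h hsol)
    fun h => hper.snd_eq_zero_of_le h.le hsol
  have hx : x t = x s := is_const_of_deriv_eq_zero (fun t => (hsol t).1.differentiableAt)
    (fun t => by rw [(hsol t).1.deriv, hy t]) t s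
  exact hne (by rw [hx, hy t, hy s])
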